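/- Let R : C ⥤ D be a monadic functor and let R' : D ⥤ D' be a functor that has a left adjoint and is split, i.e., there exists a functor S' : D' ⥤ D together with a natural isomorphism S' ∘ R' ≅ Id_D. Then the composite R' ∘ R : C ⥤ D' is monadic. -/

import Mathlib

open CategoryTheory Limits

universe v₁ v₂ v₃ u₁ u₂ u₃

/-- Transport a split coequalizer along isomorphisms. -/
def splitCoequalizerOfIso {C : Type u₁} [Category.{v₁} C] {X Y Z X' Y' Z' : C}
    {f g : X ⟶ Y} {p : Y ⟶ Z} (t : IsSplitCoequalizer f g p)
    (a : X ≅ X') (b : Y ≅ Y') (c : Z ≅ Z') {f' g' : X' ⟶ Y'} {p' : Y' ⟶ Z'}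
    (hf : a.hom ≫ f' = f ≫ b.hom) (hg : a.hom ≫ g' = g ≫ b.hom)
    (hp : b.hom ≫ p' = p ≫ c.hom) : IsSplitCoequalizer f' g' p' where
  rightSection := c.inv ≫ t.rightSection ≫ b.hom
  leftSection := b.inv ≫ t.leftSection ≫ a.hom
  condition := by
    rw [← cancel_epi a.hom, reassoc_of% hf, reassoc_of% hg, hp, t.condition_assoc]
  rightSection_π := by simp [hp]
  leftSection_bottom := by simp [hg]
  leftSection_top := by
    have : p' = b.inv ≫ p ≫ c.hom := by rw [← hp]; simp
    simp [hf, this]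

section Beck

variable {C : Type u₁} [Category.{v₁} C] {D : Type u₂}
    [Category.{v₂} D] {F : D ⥤ C} {G : C ⥤ D} (adj : F ⊣ G)

/-- The counit, with a syntactically clean type. -/
def cleanCounit (X : C) : F.obj (G.obj X) ⟶ X := adj.counit.app X

/-- The unit, with a syntactically clean type. -/
def cleanUnit (X : D) : X ⟶ G.obj (F.obj X) := adj.unit.app X

/-- The structure map of an algebra, with a syntactically clean type. -/
def cleanAct (A : adj.toMonad.Algebra) : G.obj (F.obj A.A) ⟶ A.A := A.a

theorem cleanCounit_naturality {X Y : C} (f : X ⟶ Y) :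
    F.map (G.map f) ≫ cleanCounit adj Y = cleanCounit adj X ≫ f := adj.counit_naturality f

theorem clean_triangle (X : C) :
    cleanUnit adj (G.obj X) ≫ G.map (cleanCounit adj X) = 𝟙 (G.obj X) :=
  adj.right_triangle_components X

theorem cleanAct_unit (A : adj.toMonad.Algebra) : cleanUnit adj A.A ≫ cleanAct adj A = 𝟙 A.A :=
  A.unit

/-- A variant of Beck's theorem without restrictions on universes. -/
theorem comparison_isEquivalence_aux
    (h₁ : ∀ X : C, Nonempty (IsColimit (Cofork.ofπ (f := F.map (G.map (cleanCounit adj X)))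
      (g := cleanCounit adj (F.obj (G.obj X))) (cleanCounit adj X)
      (cleanCounit_naturality adj _))))
    (h₂ : ∀ A : adj.toMonad.Algebra, ∃ (Q : C) (q : F.obj A.A ⟶ Q)
      (w : F.map (cleanAct adj A) ≫ q = cleanCounit adj (F.obj A.A) ≫ q),
      Nonempty (IsColimit (Cofork.ofπ (f := G.map (F.map (cleanAct adj A)))
        (g := G.map (cleanCounit adj (F.obj A.A))) (G.map q)
        (by rw [← G.map_comp, w, G.map_comp])))) :
    (Monad.comparison adj).IsEquivalence where
  faithful := ⟨fun {X Y} f g h => by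
    have h' : G.map f = G.map g := congrArg Monad.Algebra.Hom.f h
    apply Cofork.IsColimit.hom_ext (h₁ X).some
    change cleanCounit adj X ≫ f = cleanCounit adj X ≫ g
    rw [← cleanCounit_naturality, ← cleanCounit_naturality, h']⟩
  full := ⟨fun {X Y} h => by
    let k : G.obj X ⟶ G.obj Y := h.f
    have hk : G.map (F.map k) ≫ G.map (cleanCounit adj Y) = G.map (cleanCounit adj X) ≫ k := h.h
    have hw : F.map (G.map (cleanCounit adj X)) ≫ F.map k ≫ cleanCounit adj Y =
        cleanCounit adj (F.obj (G.obj X)) ≫ F.map k ≫ cleanCounit adj Y := by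
      rw [← Category.assoc, ← F.map_comp, ← hk, F.map_comp, Category.assoc,
        cleanCounit_naturality, ← Category.assoc, cleanCounit_naturality, Category.assoc]
    obtain ⟨m, hm⟩ : ∃ m : X ⟶ Y, cleanCounit adj X ≫ m = F.map k ≫ cleanCounit adj Y :=
      ⟨_, (Cofork.IsColimit.desc' (h₁ X).some _ hw).2⟩
    refine ⟨m, ?_⟩
    apply Monad.Algebra.Hom.ext
    change G.map m = k
    rw [← Category.id_comp (G.map m), ← clean_triangle adj, Category.assoc, ← G.map_comp, hm,
      G.map_comp, hk, ← Category.assoc, clean_triangle, Category.id_comp]⟩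
  essSurj := ⟨fun A => by
    obtain ⟨Q, q, w, ⟨hq⟩⟩ := h₂ A
    let i : A.A ≅ G.obj Q := IsColimit.coconePointUniqueUpToIso (Monad.beckCoequalizer A) hq
    have hi : cleanAct adj A ≫ i.hom = G.map q :=
      IsColimit.comp_coconePointUniqueUpToIso_hom (Monad.beckCoequalizer A) hq
        WalkingParallelPair.one
    have hu : G.map (F.map (cleanUnit adj A.A)) ≫ G.map (F.map (cleanAct adj A)) = 𝟙 _ := by
      rw [← G.map_comp, ← F.map_comp, cleanAct_unit]
      simp
    have key : G.map (F.map (cleanAct adj A)) ≫ G.map (F.map i.hom) ≫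
          G.map (cleanCounit adj Q) =
        G.map (F.map (cleanAct adj A)) ≫ cleanAct adj A ≫ i.hom := by
      rw [← Category.assoc, ← G.map_comp, ← F.map_comp, hi, ← G.map_comp,
        cleanCounit_naturality, ← w, G.map_comp]
    refine ⟨Q, ⟨(Monad.Algebra.isoMk (A := A) (B := (Monad.comparison adj).obj Q) i ?_).symm⟩⟩
    change G.map (F.map i.hom) ≫ G.map (cleanCounit adj Q) = cleanAct adj A ≫ i.hom
    have := G.map (F.map (cleanUnit adj A.A)) ≫= key
    rwa [reassoc_of% hu, reassoc_of% hu] at this⟩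

end Beck

/-- A monadic functor creates coequalizers of split pairs (no restrictions on universes). -/
theorem nonempty_creates_of_monadic {C : Type u₁} [Category.{v₁} C] {D : Type u₂}
    [Category.{v₂} D] (R : C ⥤ D) [MonadicRightAdjoint R] {A B : C} (f g : A ⟶ B)
    [R.IsSplitPair f g] : Nonempty (CreatesColimit (parallelPair f g) R) := by
  constructor
  apply +allowSynthFailures monadicCreatesColimitOfPreservesColimit
  all_goals
    apply @preservesColimit_of_iso_diagram _ _ _ _ _ _ _ _ _ (diagramIsoParallelPair _).symm ?_
    dsimp
    infer_instance

theorem comp_monadic_of_monadic_of_split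
    {C : Type u₁} [Category.{v₁} C] {D : Type u₂} [Category.{v₂} D]
    {D' : Type u₃} [Category.{v₃} D']
    (R : C ⥤ D) [MonadicRightAdjoint R]
    (R' : D ⥤ D') [R'.IsRightAdjoint]
    (S' : D' ⥤ D) (splitting : R' ⋙ S' ≅ 𝟭 D) :
    Nonempty (MonadicRightAdjoint (R ⋙ R')) := by
  let adj := (Adjunction.ofIsRightAdjoint R').comp (monadicAdjunction R)
  refine ⟨⟨_, adj, comparison_isEquivalence_aux adj (fun X => ?_) (fun A => ?_)⟩⟩
  · have t := Monad.beckSplitCoequalizer ((Monad.comparison adj).obj X)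
    have t' : IsSplitCoequalizer
        (R.map ((R'.leftAdjoint ⋙ monadicLeftAdjoint R).map ((R ⋙ R').map (cleanCounit adj X))))
        (R.map (cleanCounit adj ((R'.leftAdjoint ⋙ monadicLeftAdjoint R).obj ((R ⋙ R').obj X))))
        (R.map (cleanCounit adj X)) :=
      splitCoequalizerOfIso (t.map S') (splitting.app _) (splitting.app _) (splitting.app _)
        (splitting.hom.naturality _).symm (splitting.hom.naturality _).symm
        (splitting.hom.naturality _).symm
    have : R.IsSplitPair
        ((R'.leftAdjoint ⋙ monadicLeftAdjoint R).map ((R ⋙ R').map (cleanCounit adj X)))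
        (cleanCounit adj ((R'.leftAdjoint ⋙ monadicLeftAdjoint R).obj ((R ⋙ R').obj X))) :=
      ⟨_, _, ⟨t'⟩⟩
    have := (nonempty_creates_of_monadic R
      ((R'.leftAdjoint ⋙ monadicLeftAdjoint R).map ((R ⋙ R').map (cleanCounit adj X)))
      (cleanCounit adj ((R'.leftAdjoint ⋙ monadicLeftAdjoint R).obj ((R ⋙ R').obj X)))).some
    exact ⟨isColimitOfIsColimitCoforkMap R _ t'.isCoequalizer⟩
  · have t := Monad.beckSplitCoequalizer A
    let f := (R'.leftAdjoint ⋙ monadicLeftAdjoint R).map (cleanAct adj A)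
    let g := cleanCounit adj ((R'.leftAdjoint ⋙ monadicLeftAdjoint R).obj A.A)
    have t' : IsSplitCoequalizer (R.map f) (R.map g) (splitting.inv.app _ ≫ S'.map A.a) :=
      splitCoequalizerOfIso (t.map S') (splitting.app _) (splitting.app _) (Iso.refl _)
        (splitting.hom.naturality _).symm (splitting.hom.naturality _).symm
        (by
          have := splitting.hom_inv_id_app_assoc _ (S'.map A.a)
          exact this.trans (Category.comp_id _).symm)
    have : R.IsSplitPair f g := ⟨_, _, ⟨t'⟩⟩
    have := (nonempty_creates_of_monadic R f g).some
    have : HasColimit (parallelPair f g ⋙ R) := by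
      rw [hasColimit_iff_of_iso (diagramIsoParallelPair _)]
      exact inferInstanceAs <| HasCoequalizer (R.map f) (R.map g)
    have : HasCoequalizer f g := hasColimit_of_created (parallelPair f g) R
    have hR := isColimitOfHasCoequalizerOfPreservesColimit R f g
    have hR' := isColimitCoforkMapOfIsColimit R' _ hR
    exact ⟨coequalizer f g, coequalizer.π f g, coequalizer.condition f g,
      ⟨hR'⟩⟩
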